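/- Assume Σ_{l=1}^L γ_l M_l < |N| and that all gains are equal: h_{lj} = h > 0 for all classes l and all base stations j. Then every Nash equilibrium m of the nonatomic base station association game is system optimal: it minimizes the system cost C(m) = Σ_{j ∈ N} Σ_{l=1}^L m_{lj} g_{lj} / (1 − m_j) over all congestion profiles (with C(m) = +∞ if some m_j ≥ 1 with positive mass at that BS). In particular, at every Nash equilibrium the congestion at each BS equals (Σ_l γ_l M_l)/|N|. -/

import Mathlib

open scoped BigOperators ENNReal

/-- `m` is a congestion profile: nonnegative entries, class `l` has total mass `Ml l`. -/
def IsProfile {L N : Type*} [Fintype N] (Ml : L → ℝ) (m : L → N → ℝ) : Prop :=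
  (∀ l j, 0 ≤ m l j) ∧ ∀ l, (∑ j, m l j) = Ml l

/-- Congestion `m_j = ∑_l γ_l m_{lj}` at base station `j`. -/
noncomputable def cong {L N : Type*} [Fintype L] (γ : L → ℝ) (m : L → N → ℝ) (j : N) : ℝ :=
  ∑ l, γ l * m l j

/-- The constant `g_{lj} = γ_l σ² / h_{lj}`. -/
noncomputable def gq {L N : Type*} (σ2 : ℝ) (γ : L → ℝ) (h : L → N → ℝ) (l : L) (j : N) : ℝ :=
  γ l * σ2 / h l j

/-- Cost density of class `l` at base station `j`: `g_{lj}/(1 − m_j)` if `m_j < 1`,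
and `+∞` otherwise. -/
noncomputable def cd {L N : Type*} [Fintype L] (σ2 : ℝ) (γ : L → ℝ) (h : L → N → ℝ)
    (m : L → N → ℝ) (l : L) (j : N) : ℝ≥0∞ :=
  if cong γ m j < 1 then ENNReal.ofReal (gq σ2 γ h l j / (1 - cong γ m j)) else ⊤

/-- `m` is a Nash equilibrium of the nonatomic association game: whenever class `l` has
positive mass at base station `j`, `j` has minimal cost density for class `l`. -/
def IsNE {L N : Type*} [Fintype L] (σ2 : ℝ) (γ : L → ℝ) (h : L → N → ℝ)
    (m : L → N → ℝ) : Prop :=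
  ∀ (l : L) (j k : N), 0 < m l j → cd σ2 γ h m l j ≤ cd σ2 γ h m l k

/-- System cost `C(m) = ∑_j ∑_l m_{lj} g_{lj}/(1 − m_j)`, equal to `+∞` as soon as some
base station `j` has `m_j ≥ 1` and carries positive mass. -/
noncomputable def CsysE {L N : Type*} [Fintype L] [Fintype N]
    (σ2 : ℝ) (γ : L → ℝ) (h : L → N → ℝ) (m : L → N → ℝ) : ℝ≥0∞ :=
  ∑ j, ∑ l, ENNReal.ofReal (m l j) * cd σ2 γ h m l j

theorem cong_nonneg_aux {L N : Type*} [Fintype L] [Fintype N] (γ Ml : L → ℝ)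
    (hγ : ∀ l, 0 < γ l) (m : L → N → ℝ) (hm : IsProfile Ml m) (j : N) : 0 ≤ cong γ m j :=
  Finset.sum_nonneg fun l _ => mul_nonneg (hγ l).le (hm.1 l j)

theorem cong_sum_aux {L N : Type*} [Fintype L] [Fintype N] (γ Ml : L → ℝ)
    (m : L → N → ℝ) (hm : IsProfile Ml m) : ∑ j, cong γ m j = ∑ l, γ l * Ml l := by
  unfold cong
  rw [Finset.sum_comm]
  refine Finset.sum_congr rfl fun l _ => ?_
  rw [← Finset.mul_sum, hm.2 l]

theorem exists_pos_aux {L N : Type*} [Fintype L] (γ : L → ℝ)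
    (hγ : ∀ l, 0 < γ l) (m : L → N → ℝ) (j : N) (hj : 0 < cong γ m j) : ∃ l, 0 < m l j := by
  by_contra! hcon
  exact absurd hj (not_lt.2 (Finset.sum_nonpos fun l _ =>
    mul_nonpos_of_nonneg_of_nonpos (hγ l).le (hcon l)))

theorem inner_cost_aux {L N : Type*} [Fintype L] [Fintype N] (σ2 : ℝ) (hσ : 0 < σ2)
    (γ Ml : L → ℝ) (hγ : ∀ l, 0 < γ l) (hc : ℝ) (hhc : 0 < hc)
    (m : L → N → ℝ) (hm : IsProfile Ml m) (j : N) (hj : cong γ m j < 1) :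
    ∑ l, ENNReal.ofReal (m l j) * cd σ2 γ (fun _ _ => hc) m l j =
      ENNReal.ofReal (σ2 / hc * (cong γ m j / (1 - cong γ m j))) := by
  have h1 : 0 < 1 - cong γ m j := by linarith
  have key : ∀ l, ENNReal.ofReal (m l j) * cd σ2 γ (fun _ _ => hc) m l j =
      ENNReal.ofReal (γ l * m l j * (σ2 / hc / (1 - cong γ m j))) := by
    intro l
    rw [cd, if_pos hj, ← ENNReal.ofReal_mul (hm.1 l j), gq]
    congr 1
    ring
  rw [Finset.sum_congr rfl fun l _ => key l, ← ENNReal.ofReal_sum_of_nonneg, ← Finset.sum_mul]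
  · congr 1
    change cong γ m j * _ = _
    ring
  · intro l _
    have := hm.1 l j
    have := hγ l
    positivity

theorem tangent_aux (a x : ℝ) (ha : a < 1) (hx : x < 1) :
    a / (1 - a) + (x - a) / (1 - a) ^ 2 ≤ x / (1 - x) := by
  have h1 : 0 < 1 - a := by linarith
  have h2 : 0 < 1 - x := by linarith
  have : x / (1 - x) - (a / (1 - a) + (x - a) / (1 - a) ^ 2) =
      (x - a) ^ 2 / ((1 - x) * (1 - a) ^ 2) := by
    field_simp
    ring
  have h3 : 0 ≤ (x - a) ^ 2 / ((1 - x) * (1 - a) ^ 2) := by positivity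
  linarith

/-- Under feasibility `∑_l γ_l M_l < |N|` and identical gains `h_{lj} = h`: every Nash
equilibrium of the nonatomic association game is system optimal, and its congestion at
each base station equals `(∑_l γ_l M_l)/|N|`. -/
theorem nonatomic_collocated_ne_system_optimal {L N : Type*} [Fintype L] [Fintype N]
    (σ2 : ℝ) (hσ : 0 < σ2) (γ Ml : L → ℝ) (hγ : ∀ l, 0 < γ l) (hMl : ∀ l, 0 < Ml l)
    (hc : ℝ) (hhc : 0 < hc)
    (hfeas : (∑ l, γ l * Ml l) < Fintype.card N)
    (m : L → N → ℝ) (hm : IsProfile Ml m) (hNE : IsNE σ2 γ (fun _ _ => hc) m) :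
    (∀ m' : L → N → ℝ, IsProfile Ml m' →
      CsysE σ2 γ (fun _ _ => hc) m ≤ CsysE σ2 γ (fun _ _ => hc) m') ∧
    (∀ j : N, cong γ m j = (∑ l, γ l * Ml l) / (Fintype.card N : ℝ)) := by
  classical
  have hS := cong_sum_aux γ Ml m hm
  obtain ⟨k0, hk0⟩ : ∃ k, cong γ m k < 1 := by
    by_contra! hcon
    have : ∑ _j : N, (1 : ℝ) ≤ ∑ j, cong γ m j := Finset.sum_le_sum fun j _ => hcon j
    simp only [Finset.sum_const, Finset.card_univ, nsmul_eq_mul, mul_one] at this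
    linarith
  have hlt : ∀ j, cong γ m j < 1 := by
    intro j
    by_contra hj
    obtain ⟨l, hl⟩ := exists_pos_aux γ hγ m j (by linarith)
    have := hNE l j k0 hl
    rw [cd, cd, if_neg hj, if_pos hk0] at this
    exact ENNReal.ofReal_ne_top (top_le_iff.1 this)
  have hle : ∀ j k, cong γ m j ≤ cong γ m k := by
    intro j k
    by_contra! hjk
    have hk := cong_nonneg_aux γ Ml hγ m hm k
    obtain ⟨l, hl⟩ := exists_pos_aux γ hγ m j (by linarith)
    have h := hNE l j k hl
    have hg : 0 < γ l * σ2 / hc := by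
      have := hγ l
      positivity
    have h1 : 0 < 1 - cong γ m j := by linarith [hlt j]
    have h2 : 0 < 1 - cong γ m k := by linarith [hlt k]
    rw [cd, cd, if_pos (hlt j), if_pos (hlt k), gq, gq,
      ENNReal.ofReal_le_ofReal_iff (by positivity), div_le_div_iff_of_pos_left hg h1 h2] at h
    linarith
  have hn : (0 : ℝ) < Fintype.card N := by
    have : Nonempty N := ⟨k0⟩
    exact_mod_cast Fintype.card_pos
  have hconst : ∀ j, cong γ m j = cong γ m k0 := fun j => le_antisymm (hle _ _) (hle _ _)
  refine ⟨?_, ?_⟩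
  · intro m' hm'
    have hS' := cong_sum_aux γ Ml m' hm'
    by_cases hall : ∀ j, cong γ m' j < 1
    · unfold CsysE
      rw [Finset.sum_congr rfl fun j _ => inner_cost_aux σ2 hσ γ Ml hγ hc hhc m hm j (hlt j),
        Finset.sum_congr rfl fun j _ => inner_cost_aux σ2 hσ γ Ml hγ hc hhc m' hm' j (hall j),
        ← ENNReal.ofReal_sum_of_nonneg, ← ENNReal.ofReal_sum_of_nonneg]
      · apply ENNReal.ofReal_le_ofReal
        rw [← Finset.mul_sum, ← Finset.mul_sum]
        apply mul_le_mul_of_nonneg_left _ (by positivity)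
        have h1 : ∑ j, (cong γ m j / (1 - cong γ m j) +
            (cong γ m' j - cong γ m j) / (1 - cong γ m k0) ^ 2) ≤
            ∑ j, cong γ m' j / (1 - cong γ m' j) := by
          refine Finset.sum_le_sum fun j _ => ?_
          rw [hconst j]
          exact tangent_aux _ _ hk0 (hall j)
        rw [Finset.sum_add_distrib, ← Finset.sum_div, Finset.sum_sub_distrib, hS, hS',
          sub_self, zero_div, add_zero] at h1
        exact h1
      · intro j _
        have := cong_nonneg_aux γ Ml hγ m' hm' j
        have : 0 < 1 - cong γ m' j := by linarith [hall j]
        positivity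
      · intro j _
        have := cong_nonneg_aux γ Ml hγ m hm j
        have : 0 < 1 - cong γ m j := by linarith [hlt j]
        positivity
    · push Not at hall
      obtain ⟨j, hj⟩ := hall
      obtain ⟨l, hl⟩ := exists_pos_aux γ hγ m' j (by linarith)
      have htop : CsysE σ2 γ (fun _ _ => hc) m' = ⊤ := by
        unfold CsysE
        refine ENNReal.sum_eq_top.2 ⟨j, Finset.mem_univ _, ENNReal.sum_eq_top.2
          ⟨l, Finset.mem_univ _, ?_⟩⟩
        rw [cd, if_neg (not_lt.2 hj)]
        exact ENNReal.mul_top (ENNReal.ofReal_pos.2 hl).ne'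
      rw [htop]
      exact le_top
  · intro j
    rw [eq_div_iff hn.ne', ← hS, Finset.sum_congr rfl fun i _ => hconst i, hconst j]
    simp [mul_comm]
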